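/- Let (ū, T̄) be a minimizer of problem P(t, x_t) with coefficients ε ∈ [0,1], ρ ≥ 1, and trajectory x̄, and let σ ∈ (0, δ] satisfy σ ≤ T̄ − T_min. If the problem P(t+σ, x̄(t+σ)) with the same coefficients attains its minimum, then V(x̄(t+σ)) − V(x_t) ≤ −σ − ε ∫_t^{t+σ} L(x̄(s), ū(s)) ds; in particular, since L(x,u) ≥ α_L(‖x‖) and ξ ∈ (0,1), V(x̄(t+σ)) − V(x_t) ≤ −ξ ε ∫_t^{t+σ} α_L(‖x̄(s)‖) ds, which is strictly negative unless x̄ ≡ 0 on [t, t+σ]. -/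

import Mathlib

open Set MeasureTheory Filter Topology Matrix

noncomputable section

/-- `ℝⁿ` with the Euclidean norm. -/
abbrev Vec (n : ℕ) := EuclideanSpace ℝ (Fin n)

/-- A function is piecewise continuous on a set if it is continuous off a
finite set of points. -/
def PiecewiseContinuousOn {m : ℕ} (u : ℝ → Vec m) (s : Set ℝ) : Prop :=
  ∃ D : Finset ℝ, ContinuousOn u (s \ (D : Set ℝ))

/-- The compact control box `U = {u : u_min ≤ u ≤ u_max componentwise}`. -/
def ControlBox {m : ℕ} (umin umax : Vec m) : Set (Vec m) :=
  {u | ∀ j, umin j ≤ u j ∧ u j ≤ umax j}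

/-- `x` solves `ẋ(τ) = f(x(τ), u(τ))` on the set `s`. -/
def IsTrajectoryOn {n m : ℕ} (f : Vec n → Vec m → Vec n)
    (x : ℝ → Vec n) (u : ℝ → Vec m) (s : Set ℝ) : Prop :=
  ∀ τ ∈ s, HasDerivAt x (f (x τ) (u τ)) τ

/-- The control `u` (with response `x`) is admissible at `xt` on `[t, t+T]`:
piecewise continuous, `U`-valued, solving the system from `xt`, with terminal
state in `Ω`. -/
structure IsAdmissible {n m : ℕ} (f : Vec n → Vec m → Vec n)
    (Uset : Set (Vec m)) (Ω : Set (Vec n))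
    (t T : ℝ) (xt : Vec n) (u : ℝ → Vec m) (x : ℝ → Vec n) : Prop where
  pc : PiecewiseContinuousOn u (Icc t (t + T))
  memU : ∀ s ∈ Icc t (t + T), u s ∈ Uset
  traj : IsTrajectoryOn f x u (Icc t (t + T))
  init : x t = xt
  term : x (t + T) ∈ Ω

/-- Class `𝒦` function: continuous, strictly increasing, vanishing at `0`. -/
def ClassK (φ : ℝ → ℝ) : Prop :=
  ContinuousOn φ (Ici 0) ∧ StrictMonoOn φ (Ici 0) ∧ φ 0 = 0

/-- The quadratic form `xᵀ M x`. -/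
def quadForm {k : ℕ} (M : Matrix (Fin k) (Fin k) ℝ) (x : Vec k) : ℝ :=
  ∑ i, ∑ j, x i * M i j * x j

/-- The cost `J(u, T; x_t) = T + ε ∫ₜ^{t+T} L(x,u) + ρ q(x(t+T))`. -/
def cost {n m : ℕ} (L : Vec n → Vec m → ℝ) (q : Vec n → ℝ)
    (ε ρ t T : ℝ) (x : ℝ → Vec n) (u : ℝ → Vec m) : ℝ :=
  T + ε * (∫ s in t..(t + T), L (x s) (u s)) + ρ * q (x (t + T))

/-- `(ū, T̄, x̄)` solves problem `P(t, x_t)`: it is admissible with `T̄ ≥ T_min`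
and minimizes the cost among all admissible pairs with horizon `≥ T_min`. -/
structure IsMinimizer {n m : ℕ} (f : Vec n → Vec m → Vec n)
    (Uset : Set (Vec m)) (Ω : Set (Vec n)) (L : Vec n → Vec m → ℝ) (q : Vec n → ℝ)
    (ε ρ Tmin t : ℝ) (xt : Vec n)
    (ubar : ℝ → Vec m) (Tbar : ℝ) (xbar : ℝ → Vec n) : Prop where
  hT : Tmin ≤ Tbar
  adm : IsAdmissible f Uset Ω t Tbar xt ubar xbar
  opt : ∀ (u : ℝ → Vec m) (T : ℝ) (x : ℝ → Vec n), Tmin ≤ T →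
      IsAdmissible f Uset Ω t T xt u x →
      cost L q ε ρ t Tbar xbar ubar ≤ cost L q ε ρ t T x u

/-- Stabilizing assumption: from every point of `Ω` there is a piecewise
continuous `U`-valued control on `[0,δ]` whose trajectory stays in `Ω` and
satisfies `(d/dτ) q(x_s(τ)) + L(x_s(τ), u_s(τ)) ≤ 0`. -/
def StabilizingAssumption {n m : ℕ} (f : Vec n → Vec m → Vec n)
    (Uset : Set (Vec m)) (Ω : Set (Vec n))
    (L : Vec n → Vec m → ℝ) (q : Vec n → ℝ) (δ : ℝ) : Prop :=
  ∀ x0 ∈ Ω, ∃ (us : ℝ → Vec m) (xs : ℝ → Vec n),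
    PiecewiseContinuousOn us (Icc 0 δ) ∧
    (∀ τ ∈ Icc (0:ℝ) δ, us τ ∈ Uset) ∧
    IsTrajectoryOn f xs us (Icc 0 δ) ∧ xs 0 = x0 ∧
    (∀ τ ∈ Icc (0:ℝ) δ, xs τ ∈ Ω) ∧
    (∀ τ ∈ Icc (0:ℝ) δ, ∃ dq : ℝ,
      HasDerivAt (fun s => q (xs s)) dq τ ∧ dq + L (xs τ) (us τ) ≤ 0)

/-- The running cost along an admissible pair is interval integrable. -/
theorem IsAdmissible.intervalIntegrable_runningCost {n m : ℕ}
    {f : Vec n → Vec m → Vec n} {umin umax : Vec m} {Ω : Set (Vec n)}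
    {L : Vec n → Vec m → ℝ} (hL : Continuous (fun p : Vec n × Vec m => L p.1 p.2))
    {t T : ℝ} (hT : 0 ≤ T) {xt : Vec n} {u : ℝ → Vec m} {x : ℝ → Vec n}
    (h : IsAdmissible f (ControlBox umin umax) Ω t T xt u x) :
    IntervalIntegrable (fun s => L (x s) (u s)) volume t (t + T) := by
  have hx : ContinuousOn x (Icc t (t + T)) := fun s hs =>
    (h.traj s hs).continuousAt.continuousWithinAt
  obtain ⟨D, hD⟩ := h.pc
  have hbox : IsCompact (ControlBox umin umax) := by
    have himage : ControlBox umin umax =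
        (EuclideanSpace.equiv (Fin m) ℝ).toHomeomorph ⁻¹'
          (Set.pi univ fun j => Icc (umin j) (umax j)) := by
      ext v
      exact ⟨fun hv j _ => hv j, fun hv j => hv j trivial⟩
    rw [himage, Homeomorph.isCompact_preimage]
    exact isCompact_univ_pi fun j => isCompact_Icc
  obtain ⟨C, hC⟩ := ((isCompact_Icc.image_of_continuousOn hx).prod hbox).exists_bound_of_continuousOn
    hL.continuousOn
  have hcont : ContinuousOn (fun s => L (x s) (u s)) (Icc t (t + T) \ (D : Set ℝ)) :=
    hL.comp_continuousOn ((hx.mono sdiff_subset).prodMk hD)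
  have hmeas : AEStronglyMeasurable (fun s => L (x s) (u s))
      (volume.restrict (Icc t (t + T))) := by
    have hae : (Icc t (t + T) \ (D : Set ℝ) : Set ℝ) =ᵐ[volume] Icc t (t + T) :=
      sdiff_null_ae_eq_self (D.finite_toSet.measure_zero volume)
    rw [← Measure.restrict_congr_set hae]
    exact hcont.aestronglyMeasurable (measurableSet_Icc.diff D.finite_toSet.measurableSet)
  rw [intervalIntegrable_iff_integrableOn_Icc_of_le (by linarith)]
  refine IntegrableOn.of_bound measure_Icc_lt_top hmeas C ?_
  filter_upwards [ae_restrict_mem measurableSet_Icc] with s hs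
  exact hC (x s, u s) ⟨mem_image_of_mem x hs, h.memU s hs⟩

/-- The tail of an admissible pair is admissible on the remaining horizon. -/
theorem IsAdmissible.tail {n m : ℕ}
    {f : Vec n → Vec m → Vec n} {Uset : Set (Vec m)} {Ω : Set (Vec n)}
    {t T σ : ℝ} (hσ : 0 ≤ σ) {xt : Vec n} {u : ℝ → Vec m} {x : ℝ → Vec n}
    (h : IsAdmissible f Uset Ω t T xt u x) :
    IsAdmissible f Uset Ω (t + σ) (T - σ) (x (t + σ)) u x := by
  have hend : t + σ + (T - σ) = t + T := by ring
  have hsub : Icc (t + σ) (t + T) ⊆ Icc t (t + T) := Icc_subset_Icc_left (by linarith)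
  refine ⟨?_, ?_, ?_, rfl, ?_⟩ <;> rw [hend]
  · obtain ⟨D, hD⟩ := h.pc
    exact ⟨D, hD.mono (sdiff_subset_sdiff_left hsub)⟩
  · exact fun s hs => h.memU s (hsub hs)
  · exact fun s hs => h.traj s (hsub hs)
  · exact h.term

/-- **Value-function decrease (cases A and B.1).** If `(ū, T̄)` minimizes
`P(t, x_t)`, `σ ∈ (0, δ]` with `σ ≤ T̄ − T_min`, and `P(t+σ, x̄(t+σ))` with the
same coefficients attains its minimum, then
`V(x̄(t+σ)) − V(x_t) ≤ −σ − ε ∫_t^{t+σ} L(x̄, ū)`; in particular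
`V(x̄(t+σ)) − V(x_t) ≤ −ξ ε ∫_t^{t+σ} α_L(‖x̄‖)`, which is strictly negative
unless `x̄ ≡ 0` on `[t, t+σ]`. -/
theorem value_decrease_case_A {n m : ℕ}
    (f : Vec n → Vec m → Vec n) (L₀ : ℝ)
    (hf : ContDiff ℝ 1 (fun p : Vec n × Vec m => f p.1 p.2))
    (hf0 : f 0 0 = 0) (hL₀ : 0 < L₀)
    (hlip : ∀ (x₁ x₂ : Vec n) (u : Vec m), ‖f x₁ u - f x₂ u‖ ≤ L₀ * ‖x₁ - x₂‖)
    (umin umax : Vec m) (hU : ∀ j, umin j < 0 ∧ 0 < umax j)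
    (Ω : Set (Vec n)) (hΩcl : IsClosed Ω) (hΩbd : Bornology.IsBounded Ω)
    (hΩsc : SimplyConnectedSpace Ω) (hΩ0 : (0 : Vec n) ∈ Ω)
    (δ Tmin : ℝ) (hδ : 0 < δ) (hTmin : δ ≤ Tmin)
    (L : Vec n → Vec m → ℝ)
    (hLC1 : ContDiff ℝ 1 (fun p : Vec n × Vec m => L p.1 p.2))
    (hL00 : L 0 0 = 0) (hLnn : ∀ x u, 0 ≤ L x u)
    (αL : ℝ → ℝ) (hαK : ClassK αL) (hαlb : ∀ x u, αL ‖x‖ ≤ L x u)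
    (q : Vec n → ℝ) (hqC1 : ContDiff ℝ 1 q) (hq0 : q 0 = 0) (hqnn : ∀ x, 0 ≤ q x)
    (ε ρ : ℝ) (hε : ε ∈ Icc (0:ℝ) 1) (hρ : 1 ≤ ρ)
    (ξ : ℝ) (hξ : ξ ∈ Ioo (0:ℝ) 1)
    (t : ℝ) (xt : Vec n)
    (ubar : ℝ → Vec m) (Tbar : ℝ) (xbar : ℝ → Vec n)
    (hmin : IsMinimizer f (ControlBox umin umax) Ω L q ε ρ Tmin t xt ubar Tbar xbar)
    (σ : ℝ) (hσ : σ ∈ Ioc (0:ℝ) δ) (hσT : σ ≤ Tbar - Tmin)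
    (u2 : ℝ → Vec m) (T2 : ℝ) (x2 : ℝ → Vec n)
    (hmin2 : IsMinimizer f (ControlBox umin umax) Ω L q ε ρ Tmin
      (t + σ) (xbar (t + σ)) u2 T2 x2) :
    cost L q ε ρ (t + σ) T2 x2 u2 - cost L q ε ρ t Tbar xbar ubar
        ≤ -σ - ε * ∫ s in t..(t + σ), L (xbar s) (ubar s) ∧
      cost L q ε ρ (t + σ) T2 x2 u2 - cost L q ε ρ t Tbar xbar ubar
        ≤ -(ξ * ε) * ∫ s in t..(t + σ), αL ‖xbar s‖ ∧
      ((∃ s ∈ Icc t (t + σ), xbar s ≠ 0) →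
        cost L q ε ρ (t + σ) T2 x2 u2 - cost L q ε ρ t Tbar xbar ubar < 0) := by
  have hσ0 : 0 < σ := hσ.1
  have hσTbar : σ ≤ Tbar := by linarith
  have hint := hmin.adm.intervalIntegrable_runningCost hLC1.continuous (by linarith)
  have hmem : t + σ ∈ uIcc t (t + Tbar) := by
    rw [uIcc_of_le (by linarith)]
    constructor <;> linarith
  have hint₁ := hint.mono_set (uIcc_subset_uIcc left_mem_uIcc hmem)
  have hint₂ := hint.mono_set (uIcc_subset_uIcc hmem right_mem_uIcc)
  have hsplit := intervalIntegral.integral_add_adjacent_intervals hint₁ hint₂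
  have hdecrease : cost L q ε ρ (t + σ) T2 x2 u2 - cost L q ε ρ t Tbar xbar ubar
      ≤ -σ - ε * ∫ s in t..(t + σ), L (xbar s) (ubar s) := by
    have hopt := hmin2.opt ubar (Tbar - σ) xbar (by linarith) (hmin.adm.tail hσ0.le)
    refine (sub_le_sub_right hopt _).trans (le_of_eq ?_)
    simp only [cost]
    rw [show t + σ + (Tbar - σ) = t + Tbar by ring, ← hsplit]
    ring
  have hα_nonneg : ∀ s, 0 ≤ αL ‖xbar s‖ := fun s => by
    rw [← hαK.2.2]
    exact hαK.2.1.monotoneOn self_mem_Ici (norm_nonneg _) (norm_nonneg _)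
  have hle : t ≤ t + σ := by linarith
  have hαint : IntervalIntegrable (fun s => αL ‖xbar s‖) volume t (t + σ) := by
    refine ContinuousOn.intervalIntegrable_of_Icc hle
      (hαK.1.comp (ContinuousOn.norm fun s hs => ?_) fun s _ => norm_nonneg _)
    exact (hmin.adm.traj s ⟨hs.1, by linarith [hs.2]⟩).continuousAt.continuousWithinAt
  have hmono : ∫ s in t..(t + σ), αL ‖xbar s‖ ≤ ∫ s in t..(t + σ), L (xbar s) (ubar s) :=
    intervalIntegral.integral_mono_on hle hαint hint₁ fun s _ => hαlb _ _
  have hα0 : 0 ≤ ∫ s in t..(t + σ), αL ‖xbar s‖ :=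
    intervalIntegral.integral_nonneg hle fun s _ => hα_nonneg s
  have hεmono := mul_le_mul_of_nonneg_left hmono hε.1
  have hεα0 := mul_nonneg hε.1 hα0
  refine ⟨hdecrease, ?_, fun _ => by linarith⟩
  have hξle := mul_le_of_le_one_left hεα0 hξ.2.le
  rw [neg_mul, mul_assoc]
  linarith
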